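/- arXiv:1205.4044 — 2 statements merged into one kernel-verified Lean document; each statement's English description precedes it below -/
import Mathlib

section
/- Let θ ∈ (0, π/2) and let K_θ be the unique K > 1 for which H_{K,θ} has a neutral fixed ray. Then H_{K_θ,θ} has exactly two fixed angles in (−π, π]: one is neutral and lies in the interval (2θ, θ + π/2), and the other is locally repelling and lies in the interval (θ − π/2, 0). -/
open Real Complex Filter Topology

/-- The affine stretch `h_{K,θ}(z) = ((K+1)/2)z + e^{2iθ}((K−1)/2) conj z`. -/
noncomputable def hK (K θ : ℝ) (z : ℂ) : ℂ :=
  (((K + 1) / 2 : ℝ) : ℂ) * z +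
    Complex.exp (2 * (θ : ℂ) * Complex.I) * (((K - 1) / 2 : ℝ) : ℂ) * (starRingEnd ℂ) z

/-- `H_{K,θ}(z) = (h_{K,θ}(z))²`. -/
noncomputable def HK (K θ : ℝ) (z : ℂ) : ℂ := (hK K θ z) ^ 2

/-- The ray `R_φ = {t e^{iφ} : t ≥ 0}`. -/
noncomputable def Ray (φ : ℝ) : Set ℂ :=
  {w : ℂ | ∃ t : ℝ, 0 ≤ t ∧ w = (t : ℂ) * Complex.exp ((φ : ℂ) * Complex.I)}

/-- `φ` is a fixed angle of `H_{K,θ}`: `H_{K,θ}(e^{iφ}) = t e^{iφ}` for some `t > 0`. -/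
noncomputable def IsFixedAngle (K θ φ : ℝ) : Prop :=
  ∃ t : ℝ, 0 < t ∧
    HK K θ (Complex.exp ((φ : ℂ) * Complex.I)) = (t : ℂ) * Complex.exp ((φ : ℂ) * Complex.I)

/-- The fixed ray `R_φ` is locally repelling. -/
noncomputable def IsRepelling (K θ φ : ℝ) : Prop :=
  1 < 2 * K / (1 + (K ^ 2 - 1) * Real.cos (φ - θ) ^ 2)

/-- The fixed ray `R_φ` is locally attracting. -/
noncomputable def IsAttracting (K θ φ : ℝ) : Prop :=
  2 * K / (1 + (K ^ 2 - 1) * Real.cos (φ - θ) ^ 2) < 1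

/-- The fixed ray `R_φ` is neutral. -/
noncomputable def IsNeutral (K θ φ : ℝ) : Prop :=
  2 * K / (1 + (K ^ 2 - 1) * Real.cos (φ - θ) ^ 2) = 1

/-- In the half angle `x = φ / 2`, the map `H_{K,θ}` multiplies `e^{iφ}` by the square of a complex
number with explicit real and imaginary parts. -/
lemma HK_exp_two_mul (K θ x : ℝ) :
    HK K θ (Complex.exp (((2 * x : ℝ) : ℂ) * Complex.I)) =
      ((((K + 1) / 2 * Real.cos x + (K - 1) / 2 * Real.cos (3 * x - 2 * θ) : ℝ) : ℂ) +
        (((K + 1) / 2 * Real.sin x - (K - 1) / 2 * Real.sin (3 * x - 2 * θ) : ℝ) : ℂ) *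
          Complex.I) ^ 2 * Complex.exp (((2 * x : ℝ) : ℂ) * Complex.I) := by
  have hsq : Complex.exp (((2 * x : ℝ) : ℂ) * Complex.I) =
      Complex.exp ((x : ℂ) * Complex.I) ^ 2 := by
    rw [← Complex.exp_nat_mul]; congr 1; push_cast; ring
  have hconj : (starRingEnd ℂ) (Complex.exp (((2 * x : ℝ) : ℂ) * Complex.I)) =
      Complex.exp (-(((2 * x : ℝ) : ℂ) * Complex.I)) := by
    rw [← Complex.exp_conj, map_mul, Complex.conj_ofReal, Complex.conj_I, mul_neg]
  have hmul : Complex.exp (2 * (θ : ℂ) * Complex.I) *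
      Complex.exp (-(((2 * x : ℝ) : ℂ) * Complex.I)) =
      Complex.exp ((x : ℂ) * Complex.I) *
        Complex.exp (((-(3 * x - 2 * θ) : ℝ) : ℂ) * Complex.I) := by
    rw [← Complex.exp_add, ← Complex.exp_add]; congr 1; push_cast; ring
  have hx : Complex.exp ((x : ℂ) * Complex.I) =
      (Real.cos x : ℂ) + (Real.sin x : ℂ) * Complex.I := by
    rw [Complex.exp_mul_I, Complex.ofReal_cos, Complex.ofReal_sin]
  have hA : Complex.exp (((-(3 * x - 2 * θ) : ℝ) : ℂ) * Complex.I) =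
      (Real.cos (3 * x - 2 * θ) : ℂ) - (Real.sin (3 * x - 2 * θ) : ℂ) * Complex.I := by
    rw [Complex.exp_mul_I, ← Complex.ofReal_cos, ← Complex.ofReal_sin, Real.cos_neg,
      Real.sin_neg]
    push_cast; ring
  have hh : hK K θ (Complex.exp (((2 * x : ℝ) : ℂ) * Complex.I)) =
      Complex.exp ((x : ℂ) * Complex.I) *
      ((((K + 1) / 2 : ℝ) : ℂ) * Complex.exp ((x : ℂ) * Complex.I) +
        (((K - 1) / 2 : ℝ) : ℂ) * Complex.exp (((-(3 * x - 2 * θ) : ℝ) : ℂ) * Complex.I)) := by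
    unfold hK
    rw [hconj]
    linear_combination (((K + 1) / 2 : ℝ) : ℂ) * hsq + (((K - 1) / 2 : ℝ) : ℂ) * hmul
  have hw : (((K + 1) / 2 : ℝ) : ℂ) * Complex.exp ((x : ℂ) * Complex.I) +
        (((K - 1) / 2 : ℝ) : ℂ) * Complex.exp (((-(3 * x - 2 * θ) : ℝ) : ℂ) * Complex.I) =
      (((K + 1) / 2 * Real.cos x + (K - 1) / 2 * Real.cos (3 * x - 2 * θ) : ℝ) : ℂ) +
        (((K + 1) / 2 * Real.sin x - (K - 1) / 2 * Real.sin (3 * x - 2 * θ) : ℝ) : ℂ) *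
          Complex.I := by
    rw [hx, hA]
    simp only [Complex.ofReal_add, Complex.ofReal_sub, Complex.ofReal_mul]
    ring
  unfold HK
  rw [hh, hw, mul_pow, ← hsq, mul_comm]

lemma one_add_mul_cos_sq_eq (K θ x : ℝ) :
    1 + (K ^ 2 - 1) * Real.cos (2 * x - θ) ^ 2 =
      ((K + 1) / 2 * Real.cos x + (K - 1) / 2 * Real.cos (3 * x - 2 * θ)) ^ 2 +
      ((K + 1) / 2 * Real.sin x - (K - 1) / 2 * Real.sin (3 * x - 2 * θ)) ^ 2 := by
  have h1 : Real.cos (2 * (2 * x - θ)) = Real.cos x * Real.cos (3 * x - 2 * θ) -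
      Real.sin x * Real.sin (3 * x - 2 * θ) := by
    rw [← Real.cos_add]; congr 1; ring
  have h2 := Real.cos_two_mul (2 * x - θ)
  linear_combination (K ^ 2 - 1) / 2 * (h1 - h2) -
    (K + 1) ^ 2 / 4 * Real.sin_sq_add_cos_sq x -
    (K - 1) ^ 2 / 4 * Real.sin_sq_add_cos_sq (3 * x - 2 * θ)

lemma isFixedAngle_two_mul_iff {K : ℝ} (hK1 : 1 < K) (θ x : ℝ) :
    IsFixedAngle K θ (2 * x) ↔
      (K + 1) / 2 * Real.sin x = (K - 1) / 2 * Real.sin (3 * x - 2 * θ) := by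
  have hN := one_add_mul_cos_sq_eq K θ x
  have hH := HK_exp_two_mul K θ x
  have hpos : 0 < 1 + (K ^ 2 - 1) * Real.cos (2 * x - θ) ^ 2 := by
    have : 0 < K ^ 2 - 1 := by nlinarith
    positivity
  unfold IsFixedAngle
  rw [hH]
  rw [hN] at hpos
  generalize (K + 1) / 2 * Real.cos x + (K - 1) / 2 * Real.cos (3 * x - 2 * θ) = P at *
  rw [← sub_eq_zero (a := (K + 1) / 2 * Real.sin x)]
  generalize (K + 1) / 2 * Real.sin x - (K - 1) / 2 * Real.sin (3 * x - 2 * θ) = Q at *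
  constructor
  · rintro ⟨t, ht, h⟩
    have h := mul_right_cancel₀ (Complex.exp_ne_zero _) h
    have hre := congrArg Complex.re h
    have him := congrArg Complex.im h
    simp [pow_two] at hre him
    by_contra hQ
    have hP : P = 0 := by
      have : P * Q = 0 := by linarith
      exact (mul_eq_zero.1 this).resolve_right hQ
    subst hP
    nlinarith [sq_nonneg Q]
  · rintro rfl
    exact ⟨P ^ 2, by simpa using hpos, by simp⟩

/-- At a fixed angle, `2K - |h|²` is the product of the radial factor with the derivative of the
fixed-angle equation. -/
lemma radial_mul_deriv_eq {K θ x : ℝ}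
    (h : (K + 1) / 2 * Real.sin x = (K - 1) / 2 * Real.sin (3 * x - 2 * θ)) :
    ((K + 1) / 2 * Real.cos x + (K - 1) / 2 * Real.cos (3 * x - 2 * θ)) *
      ((K + 1) / 2 * Real.cos x - 3 * ((K - 1) / 2 * Real.cos (3 * x - 2 * θ))) =
      2 * K - (1 + (K ^ 2 - 1) * Real.cos (2 * x - θ) ^ 2) := by
  rw [one_add_mul_cos_sq_eq, h]
  linear_combination (K + 1) ^ 2 / 2 * Real.sin_sq_add_cos_sq x -
    (K - 1) ^ 2 / 2 * Real.sin_sq_add_cos_sq (3 * x - 2 * θ) -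
    2 * ((K + 1) / 2 * Real.sin x + (K - 1) / 2 * Real.sin (3 * x - 2 * θ)) * h

/-- The fixed-angle equation factors at a double root. -/
lemma sin_sub_sin_factor {a b θ x₁ : ℝ}
    (h0 : a * Real.sin x₁ = b * Real.sin (3 * x₁ - 2 * θ))
    (h1 : a * Real.cos x₁ = 3 * (b * Real.cos (3 * x₁ - 2 * θ))) (x : ℝ) :
    a * Real.sin x - b * Real.sin (3 * x - 2 * θ) =
      4 * b * Real.sin (x - x₁) ^ 2 * Real.sin (x + 2 * x₁ - 2 * θ) := by
  obtain ⟨y, rfl⟩ : ∃ y, x = x₁ + y := ⟨x - x₁, by ring⟩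
  have e1 : 3 * (x₁ + y) - 2 * θ = (3 * x₁ - 2 * θ) + 3 * y := by ring
  have e2 : x₁ + y + 2 * x₁ - 2 * θ = (3 * x₁ - 2 * θ) + y := by ring
  rw [e1, e2, add_sub_cancel_left, Real.sin_add, Real.sin_add, Real.sin_add, Real.sin_three_mul,
    Real.cos_three_mul]
  have hs := Real.sin_sq_add_cos_sq y
  linear_combination Real.cos y * h0 + Real.sin y * h1 -
    4 * b * Real.sin (3 * x₁ - 2 * θ) * Real.cos y * hs

lemma cos_sub_cos_factor {a b θ x₁ : ℝ}
    (h0 : a * Real.sin x₁ = b * Real.sin (3 * x₁ - 2 * θ))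
    (h1 : a * Real.cos x₁ = 3 * (b * Real.cos (3 * x₁ - 2 * θ))) :
    a * Real.cos (2 * θ - 2 * x₁) - 3 * (b * Real.cos (3 * (2 * θ - 2 * x₁) - 2 * θ)) =
      4 * b * Real.sin (3 * x₁ - 2 * θ) ^ 2 := by
  obtain ⟨y, hy⟩ : ∃ y, y = 3 * x₁ - 2 * θ := ⟨_, rfl⟩
  have e1 : 2 * θ - 2 * x₁ = x₁ - y := by rw [hy]; ring
  have e2 : 3 * (x₁ - y) - 2 * θ = y - 3 * y := by rw [hy]; ring
  rw [e1, e2, ← hy, Real.cos_sub, Real.cos_sub, Real.sin_three_mul, Real.cos_three_mul]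
  rw [← hy] at h0 h1
  have hs := Real.sin_sq_add_cos_sq y
  have hc : Real.cos y ^ 2 = 1 - Real.sin y ^ 2 := by linarith
  have hc4 : Real.cos y ^ 4 = (1 - Real.sin y ^ 2) ^ 2 := by rw [← hc]; ring
  linear_combination Real.cos y * h1 + Real.sin y * h0 + 12 * b * hc - 12 * b * hc4

lemma double_root_location {a b θ x : ℝ} (hb : 0 < b) (hab : b < a) (hθ : θ ∈ Set.Ioo 0 (π / 2))
    (hx : x ∈ Set.Ioc (-(π / 2)) (π / 2))
    (h0 : a * Real.sin x = b * Real.sin (3 * x - 2 * θ))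
    (h1 : a * Real.cos x = 3 * (b * Real.cos (3 * x - 2 * θ))) :
    θ < x ∧ 2 * x < 3 * θ / 2 + π / 4 ∧ Real.sin (3 * x - 2 * θ) ≠ 0 := by
  obtain ⟨hθ0, hθ1⟩ := hθ
  obtain ⟨hx0, hx1⟩ := hx
  have hfac := sin_sub_sin_factor h0 h1
  have hs : 0 < Real.sin (2 * x - 2 * θ) := by
    have h := hfac 0
    have hs2 : 0 < Real.sin (2 * θ) := Real.sin_pos_of_pos_of_lt_pi (by linarith) (by linarith)
    rw [show 3 * 0 - 2 * θ = -(2 * θ) by ring, Real.sin_neg, Real.sin_zero, zero_add] at h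
    have hb2 := mul_pos hb hs2
    by_contra hn
    have : 0 ≤ 4 * b * Real.sin (0 - x) ^ 2 * -Real.sin (2 * x - 2 * θ) :=
      mul_nonneg (by positivity) (by linarith)
    linarith
  have hc : 0 < Real.cos (2 * x - 2 * θ) := by
    have h := hfac (π / 2)
    rw [show 3 * (π / 2) - 2 * θ = π / 2 - 2 * θ + π by ring, Real.sin_add_pi,
      Real.sin_pi_div_two_sub, Real.sin_pi_div_two,
      show π / 2 + 2 * x - 2 * θ = 2 * x - 2 * θ + π / 2 by ring, Real.sin_add_pi_div_two] at h
    have hlow : 0 < a * 1 - b * -Real.cos (2 * θ) := by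
      nlinarith [Real.neg_one_le_cos (2 * θ)]
    by_contra hn
    have : 0 ≤ 4 * b * Real.sin (π / 2 - x) ^ 2 * -Real.cos (2 * x - 2 * θ) :=
      mul_nonneg (by positivity) (by linarith)
    linarith
  have ha : 0 < a := hb.trans hab
  have hA : 0 < Real.sin (3 * x - 2 * θ) * Real.cos (3 * x - 2 * θ) := by
    have e : a * Real.sin (2 * x - 2 * θ) =
        2 * b * (Real.sin (3 * x - 2 * θ) * Real.cos (3 * x - 2 * θ)) := by
      rw [show 2 * x - 2 * θ = (3 * x - 2 * θ) - x by ring, Real.sin_sub]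
      linear_combination Real.sin (3 * x - 2 * θ) * h1 - Real.cos (3 * x - 2 * θ) * h0
    have := mul_pos ha hs
    rw [e] at this
    exact pos_of_mul_pos_right this (by positivity)
  have hxs : 0 < x := by
    have e : a ^ 2 * (Real.sin x * Real.cos x) =
        3 * b ^ 2 * (Real.sin (3 * x - 2 * θ) * Real.cos (3 * x - 2 * θ)) := by
      linear_combination a * Real.cos x * h0 + b * Real.sin (3 * x - 2 * θ) * h1
    have h2 : 0 < a ^ 2 * (Real.sin x * Real.cos x) := by rw [e]; positivity
    have h3 : 0 < Real.sin x * Real.cos x := pos_of_mul_pos_right h2 (by positivity)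
    have h4 : 0 < Real.sin x := pos_of_mul_pos_left h3
      (Real.cos_nonneg_of_mem_Icc ⟨by linarith, hx1⟩)
    by_contra hn
    linarith [Real.sin_nonpos_of_nonpos_of_neg_pi_le (not_lt.1 hn) (by linarith)]
  have hθx : θ < x := by
    by_contra hn
    linarith [Real.sin_nonpos_of_nonpos_of_neg_pi_le (x := 2 * x - 2 * θ)
      (by linarith) (by linarith)]
  have hup : 2 * x - 2 * θ < π / 2 := by
    by_contra hn
    linarith [Real.cos_nonpos_of_pi_div_two_le_of_le (x := 2 * x - 2 * θ)
      (by linarith) (by linarith)]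
  refine ⟨hθx, ?_, left_ne_zero_of_mul hA.ne'⟩
  have h := hfac (θ / 2 - π / 4)
  rw [show θ / 2 - π / 4 = -(π / 4 - θ / 2) by ring,
    show 3 * -(π / 4 - θ / 2) - 2 * θ = (π / 4 - θ / 2) - π by ring, Real.sin_sub_pi,
    Real.sin_neg] at h
  have hsp : 0 < Real.sin (π / 4 - θ / 2) :=
    Real.sin_pos_of_pos_of_lt_pi (by linarith) (by linarith)
  by_contra hn
  have hnn : 0 ≤ Real.sin (-(π / 4 - θ / 2) + 2 * x - 2 * θ) :=
    Real.sin_nonneg_of_nonneg_of_le_pi (by linarith) (by linarith)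
  have : 0 ≤ 4 * b * Real.sin (-(π / 4 - θ / 2) - x) ^ 2 *
    Real.sin (-(π / 4 - θ / 2) + 2 * x - 2 * θ) := by positivity
  nlinarith

lemma one_add_mul_cos_sq_pos {K : ℝ} (hK1 : 1 < K) (u : ℝ) :
    0 < 1 + (K ^ 2 - 1) * Real.cos u ^ 2 := by
  have : 0 < K ^ 2 - 1 := by nlinarith
  positivity

/-- at `K = K_θ` there are exactly two fixed angles, one neutral in
`(2θ, θ + π/2)` and one repelling in `(θ − π/2, 0)`. -/
theorem two_fixed_angles_at_K_theta (θ Kθ : ℝ) (hθ : θ ∈ Set.Ioo 0 (π / 2))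
    (hKθ1 : 1 < Kθ)
    (hKθneut : ∃ φ : ℝ, φ ∈ Set.Ioc (-π) π ∧ IsFixedAngle Kθ θ φ ∧ IsNeutral Kθ θ φ)
    (hKθuniq : ∀ K : ℝ, 1 < K →
      (∃ φ : ℝ, φ ∈ Set.Ioc (-π) π ∧ IsFixedAngle K θ φ ∧ IsNeutral K θ φ) → K = Kθ) :
    ∃ φ₁ φ₂ : ℝ, φ₁ ∈ Set.Ioo (2 * θ) (θ + π / 2) ∧ φ₂ ∈ Set.Ioo (θ - π / 2) 0 ∧
      IsFixedAngle Kθ θ φ₁ ∧ IsNeutral Kθ θ φ₁ ∧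
      IsFixedAngle Kθ θ φ₂ ∧ IsRepelling Kθ θ φ₂ ∧
      ∀ ψ : ℝ, ψ ∈ Set.Ioc (-π) π → IsFixedAngle Kθ θ ψ → ψ = φ₁ ∨ ψ = φ₂ := by
  obtain ⟨φ, hφ, hfix, hneut⟩ := hKθneut
  obtain ⟨x, rfl⟩ : ∃ x, φ = 2 * x := ⟨φ / 2, by ring⟩
  have h0 := (isFixedAngle_two_mul_iff hKθ1 θ x).1 hfix
  have hb : 0 < (Kθ - 1) / 2 := by linarith
  have h1 : (Kθ + 1) / 2 * Real.cos x = 3 * ((Kθ - 1) / 2 * Real.cos (3 * x - 2 * θ)) := by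
    have hpos := one_add_mul_cos_sq_pos hKθ1 (2 * x - θ)
    have hn := hneut
    unfold IsNeutral at hn
    rw [div_eq_one_iff_eq hpos.ne'] at hn
    have hr := radial_mul_deriv_eq h0
    rw [hn, sub_self] at hr
    rcases mul_eq_zero.1 hr with hr | hr
    · rw [one_add_mul_cos_sq_eq, hr, h0] at hpos
      simp at hpos
    · linarith
  obtain ⟨hl, hu, hs⟩ := double_root_location hb (by linarith) hθ
    ⟨by linarith [hφ.1], by linarith [hφ.2]⟩ h0 h1
  obtain ⟨hθ0, hθ1⟩ := hθ
  have hfac := sin_sub_sin_factor h0 h1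
  have h2 : (Kθ + 1) / 2 * Real.sin (2 * θ - 2 * x) =
      (Kθ - 1) / 2 * Real.sin (3 * (2 * θ - 2 * x) - 2 * θ) := by
    have h := hfac (2 * θ - 2 * x)
    rw [show 2 * θ - 2 * x + 2 * x - 2 * θ = 0 by ring, Real.sin_zero, mul_zero] at h
    linarith
  refine ⟨2 * x, 2 * (2 * θ - 2 * x), ⟨by linarith, by linarith⟩, ⟨by linarith, by linarith⟩, hfix,
    hneut, (isFixedAngle_two_mul_iff hKθ1 _ _).2 h2, ?_, ?_⟩
  · unfold IsRepelling
    rw [one_lt_div (one_add_mul_cos_sq_pos hKθ1 _), ← sub_pos, ← radial_mul_deriv_eq h2,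
      cos_sub_cos_factor h0 h1]
    refine mul_pos ?_ (by positivity)
    have hc : 0 < Real.cos (2 * θ - 2 * x) :=
      Real.cos_pos_of_mem_Ioo ⟨by linarith, by linarith⟩
    have hsq : ((Kθ - 1) / 2 * Real.cos (3 * (2 * θ - 2 * x) - 2 * θ)) ^ 2 <
        ((Kθ + 1) / 2 * Real.cos (2 * θ - 2 * x)) ^ 2 := by
      have e := congrArg (· ^ 2) h2
      simp only [mul_pow, Real.sin_sq] at e ⊢
      linarith
    linarith [(abs_lt.1 (abs_lt_of_sq_lt_sq hsq (by positivity))).1]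
  · intro ψ hψ hψfix
    obtain ⟨y, rfl⟩ : ∃ y, ψ = 2 * y := ⟨ψ / 2, by ring⟩
    have h := hfac y
    rw [(isFixedAngle_two_mul_iff hKθ1 _ _).1 hψfix, sub_self, eq_comm, mul_eq_zero] at h
    obtain ⟨hψ0, hψ1⟩ := hψ
    rcases h with h | h
    · left
      have h : Real.sin (y - x) = 0 := by simpa [hb.ne'] using h
      have := (Real.sin_eq_zero_iff_of_lt_of_lt (by linarith) (by linarith)).1 h
      linarith
    · right
      have := (Real.sin_eq_zero_iff_of_lt_of_lt (by linarith) (by linarith)).1 h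
      linarith
end

section
/- Let θ ∈ (0, π/2), let K_θ be the unique K > 1 for which H_{K,θ} has a neutral fixed ray, and suppose K > K_θ. Then H_{K,θ} has exactly three fixed angles φ₂ < φ₀ < φ₁ in (−π, π], with φ₀, φ₁ ∈ (2θ, θ + π/2) and φ₂ ∈ (θ − π/2, 0); the ray R_{φ₀} is locally attracting, while R_{φ₁} and R_{φ₂} are locally repelling. -/
open Real Complex Filter Topology

/-- Imaginary part of `(K cos a + i sin a) e^{-i(a-θ)/2}`; it vanishes exactly when `a + θ` is a
fixed angle of `H_{K,θ}`. -/
noncomputable def fixedAngleDefect (K θ a : ℝ) : ℝ :=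
  Real.sin a * Real.cos ((a - θ) / 2) - K * (Real.cos a * Real.sin ((a - θ) / 2))

/-- The stretch `K` for which `a + θ` is a fixed angle. -/
noncomputable def stretchOfAngle (θ a : ℝ) : ℝ :=
  (Real.sin a * Real.cos ((a - θ) / 2)) / (Real.cos a * Real.sin ((a - θ) / 2))

lemma hK_exp (K θ a : ℝ) :
    hK K θ (Complex.exp (((a + θ : ℝ) : ℂ) * Complex.I)) =
      Complex.exp (θ * Complex.I) * (K * Complex.cos a + Complex.sin a * Complex.I) := by
  have h1 : Complex.exp (((a + θ : ℝ) : ℂ) * Complex.I) =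
      Complex.exp (θ * Complex.I) * Complex.exp (a * Complex.I) := by
    rw [← Complex.exp_add]; congr 1; push_cast; ring
  have h2 : (starRingEnd ℂ) (Complex.exp (((a + θ : ℝ) : ℂ) * Complex.I)) =
      Complex.exp (-(a + θ) * Complex.I) := by
    rw [← Complex.exp_conj]; congr 1; simp; ring
  have h3 : Complex.exp (2 * (θ : ℂ) * Complex.I) * Complex.exp (-(a + θ) * Complex.I) =
      Complex.exp (θ * Complex.I) * Complex.exp (-a * Complex.I) := by
    rw [← Complex.exp_add, ← Complex.exp_add]; congr 1; ring
  unfold hK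
  rw [mul_right_comm (Complex.exp (2 * (θ : ℂ) * Complex.I)), h2, h3, h1, Complex.exp_mul_I a,
    Complex.exp_mul_I (-a), Complex.cos_neg, Complex.sin_neg]
  push_cast
  ring

lemma isFixedAngle_add_iff {K : ℝ} (hK : 0 < K) (θ a : ℝ) :
    IsFixedAngle K θ (a + θ) ↔ fixedAngleDefect K θ a = 0 := by
  set u := (a - θ) / 2 with hu
  set X : ℝ := K * Real.cos a * Real.cos u + Real.sin a * Real.sin u with hX
  set Y : ℝ := fixedAngleDefect K θ a with hY
  have hYe : Y = Real.sin a * Real.cos u - K * (Real.cos a * Real.sin u) := rfl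
  have hw : (K : ℂ) * Complex.cos a + Complex.sin a * Complex.I =
      (X + Y * Complex.I) * Complex.exp (u * Complex.I) := by
    have h := Complex.sin_sq_add_cos_sq (u : ℂ)
    rw [Complex.exp_mul_I, hYe, hX]
    push_cast
    linear_combination (-(K : ℂ) * Complex.cos a - Complex.sin a * Complex.I) * h +
      (K * Complex.cos a * Complex.sin u ^ 2 -
        Complex.sin a * Complex.cos u * Complex.sin u) * Complex.I_sq
  have he : Complex.exp (((a + θ : ℝ) : ℂ) * Complex.I) =
      (Complex.exp (θ * Complex.I) * Complex.exp (u * Complex.I)) ^ 2 := by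
    rw [← Complex.exp_add, ← Complex.exp_nat_mul]
    congr 1
    rw [hu]; push_cast; ring
  have hH : HK K θ (Complex.exp (((a + θ : ℝ) : ℂ) * Complex.I)) =
      (X + Y * Complex.I) ^ 2 * Complex.exp (((a + θ : ℝ) : ℂ) * Complex.I) := by
    rw [HK, hK_exp, hw, he]; ring
  have hfix : IsFixedAngle K θ (a + θ) ↔ ∃ t : ℝ, 0 < t ∧ ((X : ℂ) + Y * Complex.I) ^ 2 = t := by
    unfold IsFixedAngle
    rw [hH]
    simp only [mul_left_inj' (Complex.exp_ne_zero _)]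
  have hnorm : X ^ 2 + Y ^ 2 = K ^ 2 * Real.cos a ^ 2 + Real.sin a ^ 2 := by
    rw [hX, hYe]
    linear_combination (K ^ 2 * Real.cos a ^ 2 + Real.sin a ^ 2) * Real.sin_sq_add_cos_sq u
  have hpos : 0 < K ^ 2 * Real.cos a ^ 2 + Real.sin a ^ 2 := by
    have h := Real.sin_sq_add_cos_sq a
    rcases eq_or_ne (Real.cos a) 0 with hc | hc
    · rw [hc] at h ⊢; nlinarith
    · positivity
  rw [hfix]
  constructor
  · rintro ⟨t, ht, h⟩
    have hre := congrArg Complex.re h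
    have him := congrArg Complex.im h
    simp [pow_two] at hre him
    have hXY : X * Y = 0 := by linarith
    rcases mul_eq_zero.1 hXY with h0 | h0
    · rw [h0] at hre; nlinarith
    · exact h0
  · intro h
    rw [h] at hnorm
    refine ⟨X ^ 2, by nlinarith, ?_⟩
    rw [h]; push_cast; ring

lemma fixedAngleDefect_eq_zero_iff {K θ a : ℝ}
    (h : Real.cos a * Real.sin ((a - θ) / 2) ≠ 0) :
    fixedAngleDefect K θ a = 0 ↔ stretchOfAngle θ a = K := by
  rw [fixedAngleDefect, stretchOfAngle, div_eq_iff h, sub_eq_zero]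

lemma fixedAngleDefect_pi_add_pos {K θ c : ℝ} (hK : 1 ≤ K) (hθ : θ ∈ Set.Ioo 0 (π / 2))
    (hc : c ∈ Set.Icc (-(π / 2)) (π / 2)) : 0 < fixedAngleDefect K θ (c + π) := by
  obtain ⟨h1, h2⟩ := hθ
  obtain ⟨h3, h4⟩ := hc
  have hu : (c + π - θ) / 2 = (c - θ) / 2 + π / 2 := by ring
  rw [fixedAngleDefect, hu, Real.sin_add_pi, Real.cos_add_pi, Real.cos_add_pi_div_two,
    Real.sin_add_pi_div_two]
  have hp : 0 < Real.cos (c - (c - θ) / 2) :=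
    Real.cos_pos_of_mem_Ioo ⟨by linarith, by linarith⟩
  rw [Real.cos_sub] at hp
  have hcc : 0 ≤ Real.cos c := Real.cos_nonneg_of_mem_Icc ⟨h3, h4⟩
  have hcu : 0 ≤ Real.cos ((c - θ) / 2) :=
    Real.cos_nonneg_of_mem_Icc ⟨by linarith, by linarith⟩
  nlinarith [mul_nonneg (sub_nonneg.2 hK) (mul_nonneg hcc hcu)]

lemma fixedAngleDefect_sub_two_pi (K θ a : ℝ) :
    fixedAngleDefect K θ (a - 2 * π) = -fixedAngleDefect K θ a := by
  have hu : (a - 2 * π - θ) / 2 = (a - θ) / 2 - π := by ring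
  rw [fixedAngleDefect, hu, Real.sin_sub_two_pi, Real.cos_sub_two_pi, Real.cos_sub_pi,
    Real.sin_sub_pi, fixedAngleDefect]
  ring

/-- A fixed angle lies on one of the two arcs `(θ - π/2, θ)` and `(2θ, θ + π/2)`. -/
lemma mem_of_isFixedAngle {K θ ψ : ℝ} (hK : 1 ≤ K) (hθ : θ ∈ Set.Ioo 0 (π / 2))
    (hψ : ψ ∈ Set.Ioc (-π) π) (hfix : IsFixedAngle K θ ψ) :
    fixedAngleDefect K θ (ψ - θ) = 0 ∧
      (ψ - θ ∈ Set.Ioo (-(π / 2)) 0 ∨ ψ - θ ∈ Set.Ioo θ (π / 2)) := by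
  obtain ⟨h1, h2⟩ := hθ
  obtain ⟨h3, h4⟩ := hψ
  have hF : fixedAngleDefect K θ (ψ - θ) = 0 := by
    rw [← isFixedAngle_add_iff (by linarith), sub_add_cancel]; exact hfix
  refine ⟨hF, ?_⟩
  set a := ψ - θ with ha
  have hlow : -(π / 2) < a := by
    by_contra! h
    have hp := fixedAngleDefect_pi_add_pos (c := a + π) hK ⟨h1, h2⟩
      ⟨by linarith, by linarith⟩
    have := fixedAngleDefect_sub_two_pi K θ (a + π + π)
    rw [show a + π + π - 2 * π = a by ring] at this
    linarith
  have hup : a < π / 2 := by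
    by_contra! h
    have hp := fixedAngleDefect_pi_add_pos (c := a - π) hK ⟨h1, h2⟩
      ⟨by linarith, by linarith⟩
    rw [sub_add_cancel] at hp
    linarith
  rcases lt_or_ge a 0 with h | h
  · exact Or.inl ⟨hlow, h⟩
  refine Or.inr ⟨?_, hup⟩
  by_contra! hle
  have hs : 0 ≤ Real.sin a := Real.sin_nonneg_of_nonneg_of_le_pi h (by linarith)
  have hc : 0 < Real.cos a := Real.cos_pos_of_mem_Ioo ⟨hlow, hup⟩
  have hcu : 0 < Real.cos ((a - θ) / 2) :=
    Real.cos_pos_of_mem_Ioo ⟨by linarith, by linarith⟩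
  have hsu : 0 ≤ Real.sin ((θ - a) / 2) :=
    Real.sin_nonneg_of_nonneg_of_le_pi (by linarith) (by linarith)
  rw [show (θ - a) / 2 = -((a - θ) / 2) by ring, Real.sin_neg] at hsu
  have hK0 : 0 < K := by linarith
  rw [fixedAngleDefect] at hF
  have e1 : 0 ≤ Real.sin a * Real.cos ((a - θ) / 2) := by positivity
  have e2 : 0 ≤ K * (Real.cos a * -Real.sin ((a - θ) / 2)) := by positivity
  have e3 : Real.sin a * Real.cos ((a - θ) / 2) = 0 := by linarith
  have e4 : K * (Real.cos a * -Real.sin ((a - θ) / 2)) = 0 := by linarith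
  have e5 : Real.sin a = 0 := (mul_eq_zero.1 e3).resolve_right hcu.ne'
  have e6 : Real.sin ((a - θ) / 2) = 0 := by
    have := (mul_eq_zero.1 ((mul_eq_zero.1 e4).resolve_left hK0.ne')).resolve_left hc.ne'
    linarith
  rcases h.eq_or_lt with h0 | h0
  · have := Real.sin_neg_of_neg_of_neg_pi_lt (x := (a - θ) / 2) (by linarith) (by linarith)
    linarith
  · have := Real.sin_pos_of_pos_of_lt_pi h0 (by linarith)
    linarith

/-- Comparison of the derivative of the induced circle map with `1`, up to a positive factor. -/
lemma stretch_sq_mul_eq {K θ a : ℝ}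
    (hF : fixedAngleDefect K θ a = 0) :
    (2 * K - (1 + (K ^ 2 - 1) * Real.cos a ^ 2)) *
        (Real.cos a * Real.sin ((a - θ) / 2) ^ 2) =
      Real.sin a * (Real.sin (a - θ) - Real.sin a * Real.cos a) := by
  have hd : Real.sin (a - θ) = 2 * Real.sin ((a - θ) / 2) * Real.cos ((a - θ) / 2) := by
    rw [← Real.sin_two_mul]; congr 1; ring
  have hu := Real.sin_sq_add_cos_sq ((a - θ) / 2)
  have ha := Real.sin_sq_add_cos_sq a
  rw [fixedAngleDefect] at hF
  rw [hd]
  set s := Real.sin a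
  set c := Real.cos a
  set p := Real.sin ((a - θ) / 2)
  set q := Real.cos ((a - θ) / 2)
  linear_combination (-2 * p + c * (s * q + K * (c * p))) * hF + c * p ^ 2 * ha - c * s ^ 2 * hu

lemma fixedRay_type_iff {K θ a : ℝ} (hK : 1 < K) (hc : 0 < Real.cos a)
    (hs : Real.sin ((a - θ) / 2) ≠ 0) (hF : fixedAngleDefect K θ a = 0) :
    (IsRepelling K θ (a + θ) ↔
      0 < Real.sin a * (Real.sin (a - θ) - Real.sin a * Real.cos a)) ∧
    (IsAttracting K θ (a + θ) ↔
      Real.sin a * (Real.sin (a - θ) - Real.sin a * Real.cos a) < 0) ∧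
    (IsNeutral K θ (a + θ) ↔
      Real.sin a * (Real.sin (a - θ) - Real.sin a * Real.cos a) = 0) := by
  have hp : 0 < Real.cos a * Real.sin ((a - θ) / 2) ^ 2 := by positivity
  have hden : 0 < 1 + (K ^ 2 - 1) * Real.cos a ^ 2 := by
    have : 0 < K ^ 2 - 1 := by nlinarith
    positivity
  rw [← stretch_sq_mul_eq hF, mul_pos_iff_of_pos_right hp,
    mul_eq_zero_iff_right hp.ne', IsRepelling, IsAttracting, IsNeutral, add_sub_cancel_right,
    one_lt_div hden, div_lt_one hden, div_eq_one_iff_eq hden.ne', sub_pos, sub_eq_zero]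
  refine ⟨Iff.rfl, ?_, Iff.rfl⟩
  rw [← sub_neg, ← neg_pos, ← neg_pos, ← neg_mul, mul_pos_iff_of_pos_right hp]

lemma hasDerivAt_stretchOfAngle {θ a : ℝ} (h : Real.cos a * Real.sin ((a - θ) / 2) ≠ 0) :
    HasDerivAt (stretchOfAngle θ)
      ((Real.sin (a - θ) - Real.sin a * Real.cos a) / 2 /
        (Real.cos a * Real.sin ((a - θ) / 2)) ^ 2) a := by
  have hu : HasDerivAt (fun x : ℝ => (x - θ) / 2) (1 / 2) a :=
    ((hasDerivAt_id a).sub_const θ).div_const 2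
  have hd := ((Real.hasDerivAt_sin a).mul hu.cos).div ((Real.hasDerivAt_cos a).mul hu.sin) h
  refine hd.congr_deriv ?_
  have e : Real.sin (a - θ) = 2 * Real.sin ((a - θ) / 2) * Real.cos ((a - θ) / 2) := by
    rw [← Real.sin_two_mul]; congr 1; ring
  simp only [Pi.mul_apply]
  congr 1
  rw [e]
  have hu := Real.sin_sq_add_cos_sq ((a - θ) / 2)
  have ha := Real.sin_sq_add_cos_sq a
  set s := Real.sin a
  set c := Real.cos a
  set p := Real.sin ((a - θ) / 2)
  set q := Real.cos ((a - θ) / 2)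
  linear_combination p * q * ha - s * c / 2 * hu

lemma stretchOfAngle_injOn {θ : ℝ} {s : Set ℝ} (hs : Convex ℝ s)
    (hne : ∀ a ∈ s, Real.cos a * Real.sin ((a - θ) / 2) ≠ 0)
    (hD : (∀ a ∈ s, Real.sin (a - θ) - Real.sin a * Real.cos a < 0) ∨
      (∀ a ∈ s, 0 < Real.sin (a - θ) - Real.sin a * Real.cos a)) :
    Set.InjOn (stretchOfAngle θ) s := by
  have hcont : ContinuousOn (stretchOfAngle θ) s := fun a ha =>
    (hasDerivAt_stretchOfAngle (hne a ha)).continuousAt.continuousWithinAt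
  rcases hD with hD | hD
  · refine (strictAntiOn_of_deriv_neg hs hcont fun a ha => ?_).injOn
    have ha := interior_subset ha
    rw [(hasDerivAt_stretchOfAngle (hne a ha)).deriv]
    have := hne a ha
    exact div_neg_of_neg_of_pos (by linarith [hD a ha]) (by positivity)
  · refine (strictMonoOn_of_deriv_pos hs hcont fun a ha => ?_).injOn
    have ha := interior_subset ha
    rw [(hasDerivAt_stretchOfAngle (hne a ha)).deriv]
    have := hne a ha
    exact div_pos (by linarith [hD a ha]) (by positivity)

lemma sin_sub_sub_sin_mul_cos_neg {θ a : ℝ} (hθ : θ ∈ Set.Ioo 0 (π / 2))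
    (ha : a ∈ Set.Ioo (-(π / 2)) 0) : Real.sin (a - θ) - Real.sin a * Real.cos a < 0 := by
  obtain ⟨h1, h2⟩ := hθ
  obtain ⟨h3, h4⟩ := ha
  have hsθ : 0 < Real.sin θ := Real.sin_pos_of_pos_of_lt_pi h1 (by linarith)
  have hcθ : 0 < Real.cos θ := Real.cos_pos_of_mem_Ioo ⟨by linarith, h2⟩
  have hsa : Real.sin a < 0 := Real.sin_neg_of_neg_of_neg_pi_lt h4 (by linarith)
  have hca : 0 < Real.cos a := Real.cos_pos_of_mem_Ioo ⟨h3, by linarith⟩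
  rw [Real.sin_sub]
  rcases le_total θ (-a) with h | h
  · have := Real.cos_le_cos_of_nonneg_of_le_pi h1.le (by linarith) h
    rw [Real.cos_neg] at this
    nlinarith [mul_pos hca hsθ]
  · have := Real.sin_le_sin_of_le_of_le_pi_div_two (by linarith) h2.le h
    rw [Real.sin_neg] at this
    nlinarith [mul_pos (neg_pos.2 hsa) hcθ]

lemma strictMonoOn_sin_sub_sub_sin_mul_cos {θ : ℝ} (hθ : θ ∈ Set.Ioo 0 (π / 2)) :
    StrictMonoOn (fun a => Real.sin (a - θ) - Real.sin a * Real.cos a)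
      (Set.Ioo θ (π / 2)) := by
  obtain ⟨h1, h2⟩ := hθ
  refine strictMonoOn_of_deriv_pos (convex_Ioo _ _) (by fun_prop) fun a ha => ?_
  rw [interior_Ioo] at ha
  obtain ⟨h3, h4⟩ := ha
  have hd := (((hasDerivAt_id a).sub_const θ).sin).sub
    ((Real.hasDerivAt_sin a).mul (Real.hasDerivAt_cos a))
  have := Real.cos_lt_cos_of_nonneg_of_le_pi (x := a - θ) (y := 2 * a)
    (by linarith) (by linarith) (by linarith)
  rw [Real.cos_two_mul'] at this
  have hd' : deriv (fun a => Real.sin (a - θ) - Real.sin a * Real.cos a) a = _ := hd.deriv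
  rw [hd']
  simp only [id]
  nlinarith

/-- for `K > K_θ` there are exactly three fixed angles `φ₂ < φ₀ < φ₁`,
with `φ₀, φ₁ ∈ (2θ, θ + π/2)` and `φ₂ ∈ (θ − π/2, 0)`; `φ₀` attracting, the others
repelling. -/
theorem three_fixed_angles_above_K_theta (θ Kθ K : ℝ) (hθ : θ ∈ Set.Ioo 0 (π / 2))
    (hKθ1 : 1 < Kθ)
    (hKθneut : ∃ φ : ℝ, φ ∈ Set.Ioc (-π) π ∧ IsFixedAngle Kθ θ φ ∧ IsNeutral Kθ θ φ)
    (hKθuniq : ∀ K' : ℝ, 1 < K' →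
      (∃ φ : ℝ, φ ∈ Set.Ioc (-π) π ∧ IsFixedAngle K' θ φ ∧ IsNeutral K' θ φ) → K' = Kθ)
    (hKgt : Kθ < K) :
    ∃ φ₂ φ₀ φ₁ : ℝ, φ₂ < φ₀ ∧ φ₀ < φ₁ ∧
      φ₀ ∈ Set.Ioo (2 * θ) (θ + π / 2) ∧ φ₁ ∈ Set.Ioo (2 * θ) (θ + π / 2) ∧
      φ₂ ∈ Set.Ioo (θ - π / 2) 0 ∧
      IsFixedAngle K θ φ₀ ∧ IsFixedAngle K θ φ₁ ∧ IsFixedAngle K θ φ₂ ∧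
      IsAttracting K θ φ₀ ∧ IsRepelling K θ φ₁ ∧ IsRepelling K θ φ₂ ∧
      ∀ ψ : ℝ, ψ ∈ Set.Ioc (-π) π → IsFixedAngle K θ ψ →
        ψ = φ₀ ∨ ψ = φ₁ ∨ ψ = φ₂ := by
  have hθ' := hθ
  obtain ⟨h1, h2⟩ := hθ'
  have hK1 : 1 < K := hKθ1.trans hKgt
  have hK0 : 0 < K := by linarith
  have hmem {K' ψ : ℝ} (hK' : 1 < K') := mem_of_isFixedAngle (ψ := ψ) hK'.le hθ
  have hcont : Continuous (fixedAngleDefect K θ) := by unfold fixedAngleDefect; fun_prop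
  have negarc : ∀ a ∈ Set.Ioo (-(π / 2)) 0,
      Real.sin a < 0 ∧ 0 < Real.cos a ∧ Real.sin ((a - θ) / 2) ≠ 0 := fun a ha =>
    ⟨Real.sin_neg_of_neg_of_neg_pi_lt ha.2 (by linarith [ha.1]),
      Real.cos_pos_of_mem_Ioo ⟨ha.1, by linarith [ha.2]⟩,
      (Real.sin_neg_of_neg_of_neg_pi_lt (by linarith [ha.2]) (by linarith [ha.1])).ne⟩
  have posarc : ∀ a ∈ Set.Ioo θ (π / 2),
      0 < Real.sin a ∧ 0 < Real.cos a ∧ 0 < Real.sin ((a - θ) / 2) := fun a ha =>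
    ⟨Real.sin_pos_of_pos_of_lt_pi (by linarith [ha.1]) (by linarith [ha.2]),
      Real.cos_pos_of_mem_Ioo ⟨by linarith [ha.1], ha.2⟩,
      Real.sin_pos_of_pos_of_lt_pi (by linarith [ha.1]) (by linarith [ha.2])⟩
  have negD := fun a => sin_sub_sub_sin_mul_cos_neg (a := a) hθ
  have hmono := strictMonoOn_sin_sub_sub_sin_mul_cos hθ
  -- The neutral fixed ray at `Kθ` sits at the critical point of the stretch.
  obtain ⟨m, hm, hmD, hmF⟩ : ∃ m ∈ Set.Ioo θ (π / 2),
      Real.sin (m - θ) - Real.sin m * Real.cos m = 0 ∧ fixedAngleDefect Kθ θ m = 0 := by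
    obtain ⟨φ, hφ, hfix, hneut⟩ := hKθneut
    obtain ⟨hF, hmem' | hmem'⟩ := hmem hKθ1 hφ hfix
    · obtain ⟨hs, hc, hu⟩ := negarc _ hmem'
      have hn := (fixedRay_type_iff hKθ1 hc hu hF).2.2
      rw [sub_add_cancel] at hn
      exact absurd (hn.1 hneut) (mul_pos_of_neg_of_neg hs (negD _ hmem')).ne'
    · obtain ⟨hs, hc, hu⟩ := posarc _ hmem'
      have hn := (fixedRay_type_iff hKθ1 hc hu.ne' hF).2.2
      rw [sub_add_cancel] at hn
      exact ⟨_, hmem', (mul_eq_zero.1 (hn.1 hneut)).resolve_left hs.ne', hF⟩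
  obtain ⟨hm1, hm2⟩ := hm
  have ltD : ∀ a ∈ Set.Ioo θ m, Real.sin (a - θ) - Real.sin a * Real.cos a < 0 := fun a ha =>
    (hmono ⟨ha.1, ha.2.trans hm2⟩ ⟨hm1, hm2⟩ ha.2).trans_eq hmD
  have gtD : ∀ a ∈ Set.Ioo m (π / 2), 0 < Real.sin (a - θ) - Real.sin a * Real.cos a :=
    fun a ha => hmD.symm.trans_lt (hmono ⟨hm1, hm2⟩ ⟨hm1.trans ha.1, ha.2⟩ ha.1)
  have hFm : fixedAngleDefect K θ m < 0 := by
    obtain ⟨-, hc, hu⟩ := posarc m ⟨hm1, hm2⟩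
    unfold fixedAngleDefect at hmF ⊢
    nlinarith [mul_pos (sub_pos.2 hKgt) (mul_pos hc hu)]
  have hFθ : 0 < fixedAngleDefect K θ θ := by
    simp [fixedAngleDefect, Real.sin_pos_of_pos_of_lt_pi h1 (by linarith)]
  have hFr : 0 < fixedAngleDefect K θ (π / 2) := by
    simp only [fixedAngleDefect, Real.sin_pi_div_two, Real.cos_pi_div_two, one_mul, zero_mul,
      mul_zero, sub_zero]
    exact Real.cos_pos_of_mem_Ioo ⟨by linarith, by linarith⟩
  have hFl : fixedAngleDefect K θ (-(π / 2)) < 0 := by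
    simp only [fixedAngleDefect, Real.sin_neg, Real.cos_neg, Real.sin_pi_div_two,
      Real.cos_pi_div_two, zero_mul, mul_zero, sub_zero, neg_one_mul, neg_neg_iff_pos]
    exact Real.cos_pos_of_mem_Ioo ⟨by linarith, by linarith⟩
  have hFn : 0 < fixedAngleDefect K θ (-θ) := by
    have hs : 0 < Real.sin θ := Real.sin_pos_of_pos_of_lt_pi h1 (by linarith)
    have hc : 0 < Real.cos θ := Real.cos_pos_of_mem_Ioo ⟨by linarith, h2⟩
    rw [fixedAngleDefect, show (-θ - θ) / 2 = -θ by ring, Real.sin_neg, Real.cos_neg]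
    nlinarith [mul_pos (sub_pos.2 hK1) (mul_pos hs hc)]
  obtain ⟨a, ha, haF⟩ := intermediate_value_Ioo' hm1.le hcont.continuousOn ⟨hFm, hFθ⟩
  obtain ⟨b, hb, hbF⟩ := intermediate_value_Ioo hm2.le hcont.continuousOn ⟨hFm, hFr⟩
  obtain ⟨c, hc, hcF⟩ := intermediate_value_Ioo (by linarith : -(π / 2) ≤ -θ)
    hcont.continuousOn ⟨hFl, hFn⟩
  have ha' : a ∈ Set.Ioo θ (π / 2) := ⟨ha.1, ha.2.trans hm2⟩
  have hb' : b ∈ Set.Ioo θ (π / 2) := ⟨hm1.trans hb.1, hb.2⟩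
  have hc' : c ∈ Set.Ioo (-(π / 2)) 0 := ⟨hc.1, by linarith [hc.2]⟩
  have uniq {s : Set ℝ} (hs : Convex ℝ s)
      (hne : ∀ x ∈ s, Real.cos x * Real.sin ((x - θ) / 2) ≠ 0)
      (hD : (∀ x ∈ s, Real.sin (x - θ) - Real.sin x * Real.cos x < 0) ∨
        (∀ x ∈ s, 0 < Real.sin (x - θ) - Real.sin x * Real.cos x))
      {x y : ℝ} (hx : x ∈ s) (hy : y ∈ s) (hxF : fixedAngleDefect K θ x = 0)
      (hyF : fixedAngleDefect K θ y = 0) : x = y :=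
    stretchOfAngle_injOn hs hne hD hx hy
      (((fixedAngleDefect_eq_zero_iff (hne x hx)).1 hxF).trans
        ((fixedAngleDefect_eq_zero_iff (hne y hy)).1 hyF).symm)
  have posne : ∀ x ∈ Set.Ioo θ (π / 2), Real.cos x * Real.sin ((x - θ) / 2) ≠ 0 := fun x hx =>
    (mul_pos (posarc x hx).2.1 (posarc x hx).2.2).ne'
  obtain ⟨sa, ca, ua⟩ := posarc a ha'
  obtain ⟨sb, cb, ub⟩ := posarc b hb'
  obtain ⟨sc, cc, uc⟩ := negarc c hc'
  refine ⟨c + θ, a + θ, b + θ, by linarith [hc.2, ha.1], by linarith [ha.2, hb.1],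
    ⟨by linarith [ha'.1], by linarith [ha'.2]⟩, ⟨by linarith [hb'.1], by linarith [hb'.2]⟩,
    ⟨by linarith [hc.1], by linarith [hc.2]⟩,
    (isFixedAngle_add_iff hK0 θ a).2 haF, (isFixedAngle_add_iff hK0 θ b).2 hbF,
    (isFixedAngle_add_iff hK0 θ c).2 hcF,
    (fixedRay_type_iff hK1 ca ua.ne' haF).2.1.2 (mul_neg_of_pos_of_neg sa (ltD a ha)),
    (fixedRay_type_iff hK1 cb ub.ne' hbF).1.2 (mul_pos sb (gtD b hb)),
    (fixedRay_type_iff hK1 cc uc hcF).1.2 (mul_pos_of_neg_of_neg sc (negD c hc')),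
    fun ψ hψ hfix => ?_⟩
  obtain ⟨hF, hn | hp⟩ := hmem hK1 hψ hfix
  · have := uniq (convex_Ioo _ _)
      (fun x hx => mul_ne_zero (negarc x hx).2.1.ne' (negarc x hx).2.2) (Or.inl negD) hn hc' hF hcF
    exact Or.inr (Or.inr (by linarith))
  · rcases lt_trichotomy (ψ - θ) m with h | h | h
    · have := uniq (convex_Ioo _ _) (fun x hx => posne x ⟨hx.1, hx.2.trans hm2⟩) (Or.inl ltD)
        ⟨hp.1, h⟩ ha hF haF
      exact Or.inl (by linarith)
    · rw [h] at hF
      linarith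
    · have := uniq (convex_Ioo _ _) (fun x hx => posne x ⟨hm1.trans hx.1, hx.2⟩) (Or.inr gtD)
        ⟨h, hp.2⟩ hb hF hbF
      exact Or.inr (Or.inl (by linarith))
end
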